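/- Let σ ∈ [0,1]. If f and g are diffeomorphisms of ℝ^p belonging to G_σ^×(ℝ^p), then f ∘ g ∈ G_σ^×(ℝ^p) (and g^{-1} ∈ G_σ^×(ℝ^p)); moreover every linear automorphism A ∈ GL_p(ℝ) belongs to G_σ^×(ℝ^p). In particular G_σ^×(ℝ^p) is a subgroup of the group of diffeomorphisms of ℝ^p containing GL_p(ℝ). -/

import Mathlib

open MeasureTheory
open scoped BigOperators

noncomputable section

/-- Japanese bracket `⟨v⟩ = (1 + ‖v‖²)^(1/2)` (with the Euclidean norm). -/
def jb {n : ℕ} (v : Fin n → ℝ) : ℝ := Real.sqrt (1 + ∑ i, (v i) ^ 2)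

/-- Japanese bracket of a pair of vectors, `⟨(x,y)⟩`. -/
def jb2 {n m : ℕ} (x : Fin n → ℝ) (y : Fin m → ℝ) : ℝ :=
  Real.sqrt (1 + ∑ i, (x i) ^ 2 + ∑ j, (y j) ^ 2)

/-- Euclidean inner product `⟨ϑ, ζ⟩`. -/
def ip {n : ℕ} (ϑ ζ : Fin n → ℝ) : ℝ := ∑ i, ϑ i * ζ i

/-- Partial derivative in the `i`-th coordinate direction. -/
def pd {n : ℕ} {E : Type*} [NormedAddCommGroup E] [NormedSpace ℝ E]
    (i : Fin n) (f : (Fin n → ℝ) → E) : (Fin n → ℝ) → E :=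
  fun x => fderiv ℝ f x (Pi.single i 1)

/-- Iterated partial derivative `∂^ν` along the multi-index `ν`. -/
def pdm {n : ℕ} {E : Type*} [NormedAddCommGroup E] [NormedSpace ℝ E]
    (ν : Fin n → ℕ) (f : (Fin n → ℝ) → E) : (Fin n → ℝ) → E :=
  (List.finRange n).foldr (fun i g => (pd i)^[ν i] g) f

/-- Mixed partial derivative `∂_x^α ∂_y^β` of a function of two vector variables. -/
def pdm2 {n m : ℕ} {E : Type*} [NormedAddCommGroup E] [NormedSpace ℝ E]
    (α : Fin n → ℕ) (β : Fin m → ℕ) (f : (Fin n → ℝ) → (Fin m → ℝ) → E) :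
    (Fin n → ℝ) → (Fin m → ℝ) → E :=
  fun x y => pdm α (fun x' => pdm β (f x') y) x

/-- Mixed partial derivative `∂_x^α ∂_y^β ∂_z^γ` of a function of three vector variables. -/
def pdm3 {n m k : ℕ} {E : Type*} [NormedAddCommGroup E] [NormedSpace ℝ E]
    (α : Fin n → ℕ) (β : Fin m → ℕ) (γ : Fin k → ℕ)
    (f : (Fin n → ℝ) → (Fin m → ℝ) → (Fin k → ℝ) → E) :
    (Fin n → ℝ) → (Fin m → ℝ) → (Fin k → ℝ) → E :=
  fun x y z => pdm α (fun x' => pdm β (fun y' => pdm γ (f x' y') z) y) x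

/-- Length `|ν|` of a multi-index. -/
def msize {n : ℕ} (ν : Fin n → ℕ) : ℕ := ∑ i, ν i

/-- The class `G_σ(ℝ^n, E)`: smooth functions whose `ν`-th derivative is
`O(⟨v⟩^{-σ(|ν|-1)})` for every `ν ≠ 0`. -/
def GsigmaCl {n : ℕ} {E : Type*} [NormedAddCommGroup E] [NormedSpace ℝ E]
    (σ : ℝ) (f : (Fin n → ℝ) → E) : Prop :=
  ContDiff ℝ (⊤ : ℕ∞) f ∧ ∀ ν : Fin n → ℕ, ν ≠ 0 → ∃ C > 0, ∀ v,
    ‖pdm ν f v‖ ≤ C * jb v ^ (-(σ * ((msize ν : ℝ) - 1)))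

/-- The class `S_σ(ℝ^n)`: smooth real functions whose `ν`-th derivative is
`O(⟨v⟩^{-σ|ν|})` for every `ν`. -/
def SsigmaCl {n : ℕ} (σ : ℝ) (f : (Fin n → ℝ) → ℝ) : Prop :=
  ContDiff ℝ (⊤ : ℕ∞) f ∧ ∀ ν : Fin n → ℕ, ∃ C > 0, ∀ v,
    |pdm ν f v| ≤ C * jb v ^ (-(σ * (msize ν : ℝ)))

/-- `G_σ^×(ℝ^p)`: diffeomorphisms `g` of `ℝ^p` with `g` and `g⁻¹` in `G_σ`. -/
def GsigmaX {p : ℕ} (σ : ℝ) (g : (Fin p → ℝ) → (Fin p → ℝ)) : Prop :=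
  ∃ h : (Fin p → ℝ) → (Fin p → ℝ),
    Function.LeftInverse h g ∧ Function.RightInverse h g ∧ GsigmaCl σ g ∧ GsigmaCl σ h

/-- The class `O_M(ℝ^n, E)`: smooth functions with polynomially bounded derivatives. -/
def OMCl {n : ℕ} {E : Type*} [NormedAddCommGroup E] [NormedSpace ℝ E]
    (f : (Fin n → ℝ) → E) : Prop :=
  ContDiff ℝ (⊤ : ℕ∞) f ∧ ∀ ν : Fin n → ℕ, ∃ C > 0, ∃ k : ℕ, ∀ v,
    ‖pdm ν f v‖ ≤ C * jb v ^ (k : ℝ)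

/-- `O_M^×(ℝ^p, ℝ^p)`: diffeomorphisms `g` of `ℝ^p` with `g` and `g⁻¹` in `O_M`. -/
def OMX {p : ℕ} (g : (Fin p → ℝ) → (Fin p → ℝ)) : Prop :=
  ∃ h : (Fin p → ℝ) → (Fin p → ℝ),
    Function.LeftInverse h g ∧ Function.RightInverse h g ∧ OMCl g ∧ OMCl h

/-- The symbol space `S_σ^{l,m}(ℝ^{2n}, E)`. -/
def Ssym {n : ℕ} {E : Type*} [NormedAddCommGroup E] [NormedSpace ℝ E]
    (σ l m : ℝ) (a : (Fin n → ℝ) → (Fin n → ℝ) → E) : Prop :=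
  ContDiff ℝ (⊤ : ℕ∞) (fun q : (Fin n → ℝ) × (Fin n → ℝ) => a q.1 q.2) ∧
  ∀ α β : Fin n → ℕ, ∃ C > 0, ∀ x ϑ,
    ‖pdm2 α β a x ϑ‖ ≤ C * jb x ^ (σ * (l - (msize α : ℝ))) * jb ϑ ^ (m - (msize β : ℝ))

/-- The amplitude space `Π_{σ,κ}^{l,w,m}(ℝ^{3n}, E)`. -/
def Amp {n : ℕ} {E : Type*} [NormedAddCommGroup E] [NormedSpace ℝ E]
    (σ κ l w m : ℝ) (a : (Fin n → ℝ) → (Fin n → ℝ) → (Fin n → ℝ) → E) : Prop :=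
  ContDiff ℝ (⊤ : ℕ∞)
    (fun q : ((Fin n → ℝ) × (Fin n → ℝ)) × (Fin n → ℝ) => a q.1.1 q.1.2 q.2) ∧
  ∀ α β γ : Fin n → ℕ, ∃ C > 0, ∀ x ζ ϑ,
    ‖pdm3 α β γ a x ζ ϑ‖ ≤
      C * jb x ^ (σ * (l - ((msize α + msize β : ℕ) : ℝ))) *
        jb ζ ^ (w + κ * ((msize α + msize β : ℕ) : ℝ)) * jb ϑ ^ (m - (msize γ : ℝ))

/-- The space `H_{σ,κ}^{w}(E)` of smooth functions on `ℝ^{2n}`. -/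
def Hsp {n : ℕ} {F : Type*} [NormedAddCommGroup F] [NormedSpace ℝ F]
    (σ κ w : ℝ) (g : (Fin n → ℝ) → (Fin n → ℝ) → F) : Prop :=
  ContDiff ℝ (⊤ : ℕ∞) (fun q : (Fin n → ℝ) × (Fin n → ℝ) => g q.1 q.2) ∧
  ∀ α β : Fin n → ℕ, ¬(α = 0 ∧ β = 0) → ∃ C > 0, ∀ x ζ,
    ‖pdm2 α β g x ζ‖ ≤ C * jb x ^ (-(σ * (((msize α + msize β : ℕ) : ℝ) - 1))) *
      jb ζ ^ (w + κ * (((msize α + msize β : ℕ) : ℝ) - 1))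

/-- The space `E_{σ,κ}^{w}(E)` of smooth functions on `ℝ^{2n}`. -/
def Esp {n : ℕ} {F : Type*} [NormedAddCommGroup F] [NormedSpace ℝ F]
    (σ κ w : ℝ) (g : (Fin n → ℝ) → (Fin n → ℝ) → F) : Prop :=
  ContDiff ℝ (⊤ : ℕ∞) (fun q : (Fin n → ℝ) × (Fin n → ℝ) => g q.1 q.2) ∧
  ∀ α β : Fin n → ℕ, ∃ C > 0, ∀ x ζ,
    ‖pdm2 α β g x ζ‖ ≤ C * jb x ^ (-(σ * ((msize α + msize β : ℕ) : ℝ))) *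
      jb ζ ^ (w + κ * ((msize α + msize β : ℕ) : ℝ))

/-- Jacobian determinant of a map `ℝ^p → ℝ^p`. -/
def Jdet {p : ℕ} (g : (Fin p → ℝ) → (Fin p → ℝ)) : (Fin p → ℝ) → ℝ :=
  fun v => LinearMap.det (fderiv ℝ g v).toLinearMap

/-- The seminorm `q_{p,(α,β)}(K) = sup ⟨(x,y)⟩^p |∂^{(α,β)} K (x,y)|`. -/
def qSem {n : ℕ} (p : ℕ) (α β : Fin n → ℕ)
    (K : (Fin n → ℝ) → (Fin n → ℝ) → ℂ) : ℝ :=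
  ⨆ q : (Fin n → ℝ) × (Fin n → ℝ), jb2 q.1 q.2 ^ p * ‖pdm2 α β K q.1 q.2‖

/-- Mixed partial derivative `∂_r^α ∂_θ^β` of a function of two real variables. -/
def pd2 (α β : ℕ) (F : ℝ → ℝ → ℝ) (r θ : ℝ) : ℝ :=
  iteratedDeriv α (fun r' => iteratedDeriv β (fun θ' => F r' θ') θ) r

/-- Smooth real function on `ℝ` with all derivatives bounded. -/
def BddSmooth (a : ℝ → ℝ) : Prop :=
  ContDiff ℝ (⊤ : ℕ∞) a ∧ ∀ k : ℕ, ∃ C : ℝ, ∀ t, |iteratedDeriv k a t| ≤ C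

/-- Inverse hyperbolic cosine, `arcosh x = log (x + √(x²-1))`. -/
def arcosh (x : ℝ) : ℝ := Real.log (x + Real.sqrt (x ^ 2 - 1))

/-! ### Partial derivatives along lists of indices -/

/-- Iterated partial derivatives along a list of indices. -/
def plist {n : ℕ} {E : Type*} [NormedAddCommGroup E] [NormedSpace ℝ E]
    (l : List (Fin n)) (f : (Fin n → ℝ) → E) : (Fin n → ℝ) → E :=
  l.foldr (fun i g => pd i g) f

lemma pd_smooth {n : ℕ} {E : Type*} [NormedAddCommGroup E] [NormedSpace ℝ E]
    (i : Fin n) {f : (Fin n → ℝ) → E} (hf : ContDiff ℝ (⊤ : ℕ∞) f) :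
    ContDiff ℝ (⊤ : ℕ∞) (pd i f) := by
  have h : ContDiff ℝ (⊤ : ℕ∞) (fderiv ℝ f) := hf.fderiv_right (by simp)
  exact h.clm_apply contDiff_const

lemma plist_smooth {n : ℕ} {E : Type*} [NormedAddCommGroup E] [NormedSpace ℝ E]
    (l : List (Fin n)) {f : (Fin n → ℝ) → E} (hf : ContDiff ℝ (⊤ : ℕ∞) f) :
    ContDiff ℝ (⊤ : ℕ∞) (plist l f) := by
  induction l with
  | nil => exact hf
  | cons i l ih => exact pd_smooth i ih

lemma pd_comm {n : ℕ} {E : Type*} [NormedAddCommGroup E] [NormedSpace ℝ E]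
    (i j : Fin n) {f : (Fin n → ℝ) → E} (hf : ContDiff ℝ (⊤ : ℕ∞) f) :
    pd i (pd j f) = pd j (pd i f) := by
  have h : ContDiff ℝ (⊤ : ℕ∞) (fderiv ℝ f) := hf.fderiv_right (by simp)
  have key : ∀ a b : Fin n, ∀ x, pd a (pd b f) x =
      fderiv ℝ (fderiv ℝ f) x (Pi.single a 1) (Pi.single b 1) := by
    intro a b x
    have hd : DifferentiableAt ℝ (fderiv ℝ f) x := (h.differentiable (by simp)) x
    unfold pd
    rw [fderiv_clm_apply hd (differentiableAt_const _)]
    simp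
  funext x
  rw [key, key]
  have hs : IsSymmSndFDerivAt ℝ f x :=
    (hf.contDiffAt).isSymmSndFDerivAt (by
      rw [minSmoothness_of_isRCLikeNormedField]
      exact WithTop.coe_le_coe.2 (le_top : (2 : ℕ∞) ≤ ⊤))
  exact hs _ _

lemma plist_perm {n : ℕ} {E : Type*} [NormedAddCommGroup E] [NormedSpace ℝ E]
    {l l' : List (Fin n)} (hl : l.Perm l') {f : (Fin n → ℝ) → E}
    (hf : ContDiff ℝ (⊤ : ℕ∞) f) : plist l f = plist l' f := by
  induction hl with
  | nil => rfl
  | cons i _ ih => exact congrArg (pd i) ih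
  | swap i j l => exact pd_comm _ _ (plist_smooth l hf)
  | trans _ _ h1 h2 => exact h1.trans h2

/-- The sorted list of indices of a multi-index. -/
def mlist {n : ℕ} (ν : Fin n → ℕ) : List (Fin n) :=
  (List.finRange n).flatMap (fun i => List.replicate (ν i) i)

lemma pdm_eq_plist {n : ℕ} {E : Type*} [NormedAddCommGroup E] [NormedSpace ℝ E]
    (ν : Fin n → ℕ) (f : (Fin n → ℝ) → E) : pdm ν f = plist (mlist ν) f := by
  unfold pdm mlist
  have hr : ∀ (i : Fin n) (k : ℕ) (g : (Fin n → ℝ) → E),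
      (pd i)^[k] g = plist (List.replicate k i) g := by
    intro i k g
    induction k with
    | zero => rfl
    | succ k ih => rw [Function.iterate_succ_apply', ih]; rfl
  induction (List.finRange n) with
  | nil => rfl
  | cons i l ih =>
    rw [List.foldr_cons, ih, hr, List.flatMap_cons]
    unfold plist
    rw [List.foldr_append]

lemma mlist_length {n : ℕ} (ν : Fin n → ℕ) : (mlist ν).length = msize ν := by
  unfold mlist msize
  rw [List.length_flatMap, ← List.sum_ofFn, List.ofFn_eq_map]
  simp

lemma mlist_count {n : ℕ} (ν : Fin n → ℕ) (i : Fin n) : (mlist ν).count i = ν i := by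
  unfold mlist
  rw [List.count_flatMap, ← List.ofFn_eq_map, List.sum_ofFn]
  simp [List.count_replicate]

lemma perm_mlist {n : ℕ} (l : List (Fin n)) : l.Perm (mlist fun i => l.count i) := by
  rw [List.perm_iff_count]
  intro i
  rw [mlist_count]

lemma iteratedFDeriv_basis {n : ℕ} {E : Type*} [NormedAddCommGroup E] [NormedSpace ℝ E]
    {f : (Fin n → ℝ) → E} (hf : ContDiff ℝ (⊤ : ℕ∞) f) (k : ℕ) (s : Fin k → Fin n) :
    (fun x => iteratedFDeriv ℝ k f x (fun j => Pi.single (s j) 1)) = plist (List.ofFn s) f := by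
  induction k with
  | zero => funext x; simp [plist]
  | succ k ih =>
    funext x
    have hd : DifferentiableAt ℝ (iteratedFDeriv ℝ k f) x :=
      (hf.differentiable_iteratedFDeriv (by exact_mod_cast ENat.natCast_lt_top k)) x
    rw [hd.iteratedFDeriv_succ_apply_left', List.ofFn_succ]
    have := ih (fun j => s j.succ)
    change _ = pd (s 0) (plist (List.ofFn fun j => s j.succ) f) x
    rw [← this]
    rfl

lemma norm_plist_le {n : ℕ} {E : Type*} [NormedAddCommGroup E] [NormedSpace ℝ E]
    {f : (Fin n → ℝ) → E} (hf : ContDiff ℝ (⊤ : ℕ∞) f) (l : List (Fin n)) (x : Fin n → ℝ) :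
    ‖plist l f x‖ ≤ ‖iteratedFDeriv ℝ l.length f x‖ := by
  have h := congrFun (iteratedFDeriv_basis hf l.length l.get) x
  rw [List.ofFn_get] at h
  rw [← h]
  refine (ContinuousMultilinearMap.le_opNorm _ _).trans ?_
  simp [Pi.norm_single]

lemma norm_iteratedFDeriv_le_sum {n : ℕ} {E : Type*} [NormedAddCommGroup E] [NormedSpace ℝ E]
    {f : (Fin n → ℝ) → E} (hf : ContDiff ℝ (⊤ : ℕ∞) f) (k : ℕ) (x : Fin n → ℝ) :
    ‖iteratedFDeriv ℝ k f x‖ ≤ ∑ s : Fin k → Fin n, ‖plist (List.ofFn s) f x‖ := by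
  refine ContinuousMultilinearMap.opNorm_le_bound (Finset.sum_nonneg fun _ _ => norm_nonneg _) ?_
  intro m
  have hm : m = fun i => ∑ j, (m i j) • (Pi.single j (1 : ℝ) : Fin n → ℝ) := by
    funext i
    exact pi_eq_sum_univ' (m i)
  conv_lhs => rw [hm]
  rw [ContinuousMultilinearMap.map_sum, Finset.sum_mul]
  refine (norm_sum_le _ _).trans (Finset.sum_le_sum fun s _ => ?_)
  rw [ContinuousMultilinearMap.map_smul_univ, norm_smul, ← congrFun (iteratedFDeriv_basis hf k s) x,
    mul_comm, norm_prod]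
  gcongr with i _
  exact norm_le_pi_norm (m i) (s i)

/-! ### Japanese bracket -/

lemma one_le_jb {n : ℕ} (v : Fin n → ℝ) : 1 ≤ jb v := by
  unfold jb
  rw [Real.one_le_sqrt]
  have : 0 ≤ ∑ i, (v i) ^ 2 := Finset.sum_nonneg fun _ _ => sq_nonneg _
  linarith

lemma norm_le_jb {n : ℕ} (v : Fin n → ℝ) : ‖v‖ ≤ jb v := by
  rw [pi_norm_le_iff_of_nonneg (zero_le_one.trans (one_le_jb v))]
  intro i
  unfold jb
  apply Real.le_sqrt_of_sq_le
  rw [Real.norm_eq_abs, sq_abs]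
  have : (v i) ^ 2 ≤ ∑ i, (v i) ^ 2 :=
    Finset.single_le_sum (f := fun i => (v i) ^ 2) (fun _ _ => sq_nonneg _) (Finset.mem_univ i)
  linarith

lemma jb_le {n : ℕ} (v : Fin n → ℝ) : jb v ≤ 1 + n * ‖v‖ := by
  have h0 : 0 ≤ ‖v‖ := norm_nonneg v
  have hn : (n : ℝ) ≤ n ^ 2 := by exact_mod_cast Nat.le_self_pow two_ne_zero n
  have h1 : ∑ i, (v i) ^ 2 ≤ n * ‖v‖ ^ 2 := by
    have : ∑ i, (v i) ^ 2 ≤ ∑ _i : Fin n, ‖v‖ ^ 2 := by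
      refine Finset.sum_le_sum fun i _ => ?_
      rw [← sq_abs, ← Real.norm_eq_abs]
      gcongr
      exact norm_le_pi_norm v i
    simpa using this
  unfold jb
  apply Real.sqrt_le_iff.2
  have h2 : (0 : ℝ) ≤ n * ‖v‖ := by positivity
  refine ⟨by linarith, ?_⟩
  nlinarith [mul_le_mul_of_nonneg_right hn (sq_nonneg ‖v‖)]

lemma jb_rpow {n : ℕ} (σ : ℝ) (v : Fin n → ℝ) (k : ℕ) :
    jb v ^ (-(σ * (((k + 1 : ℕ) : ℝ) - 1))) = ((jb v ^ σ) ^ k)⁻¹ := by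
  have h : 0 ≤ jb v := zero_le_one.trans (one_le_jb v)
  rw [Real.rpow_neg h, Real.rpow_mul h]
  push_cast
  rw [add_sub_cancel_right, Real.rpow_natCast]

/-! ### Characterisation by Fréchet derivatives -/

lemma GsigmaCl_iff {n : ℕ} {E : Type*} [NormedAddCommGroup E] [NormedSpace ℝ E]
    (σ : ℝ) (f : (Fin n → ℝ) → E) :
    GsigmaCl σ f ↔ ContDiff ℝ (⊤ : ℕ∞) f ∧ ∀ k : ℕ, ∃ C > 0, ∀ v,
      ‖iteratedFDeriv ℝ (k + 1) f v‖ ≤ C * ((jb v ^ σ) ^ k)⁻¹ := by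
  unfold GsigmaCl
  refine and_congr_right fun hf => ⟨fun H k => ?_, fun H ν hν => ?_⟩
  · have hs : ∀ s : Fin (k + 1) → Fin n, ∃ C > 0, ∀ v,
        ‖plist (List.ofFn s) f v‖ ≤ C * ((jb v ^ σ) ^ k)⁻¹ := by
      intro s
      set ν : Fin n → ℕ := fun i => (List.ofFn s).count i with hν
      have hp : (List.ofFn s).Perm (mlist ν) := perm_mlist _
      have hsz : msize ν = k + 1 := by
        rw [← mlist_length, ← hp.length_eq, List.length_ofFn]
      have h0 : ν ≠ 0 := by
        intro h
        rw [h] at hsz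
        simp [msize] at hsz
      obtain ⟨C, hC, h⟩ := H ν h0
      refine ⟨C, hC, fun v => ?_⟩
      have := h v
      rwa [hsz, jb_rpow, pdm_eq_plist, ← plist_perm hp hf] at this
    choose C hC h using hs
    refine ⟨1 + ∑ s, C s, ?_, fun v => ?_⟩
    · have : 0 ≤ ∑ s, C s := Finset.sum_nonneg fun s _ => (hC s).le
      linarith
    · refine (norm_iteratedFDeriv_le_sum hf _ v).trans ?_
      refine (Finset.sum_le_sum fun s _ => h s v).trans ?_
      rw [← Finset.sum_mul]
      have h0 : 0 ≤ jb v := zero_le_one.trans (one_le_jb v)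
      gcongr
      linarith
  · obtain ⟨k, hk⟩ : ∃ k, msize ν = k + 1 := by
      apply Nat.exists_eq_succ_of_ne_zero
      intro h
      apply hν
      funext i
      exact (Finset.sum_eq_zero_iff.1 h) i (Finset.mem_univ i)
    obtain ⟨C, hC, h⟩ := H k
    refine ⟨C, hC, fun v => ?_⟩
    rw [hk, jb_rpow, pdm_eq_plist]
    refine (norm_plist_le hf _ v).trans ?_
    rw [mlist_length, hk]
    exact h v

/-! ### Composition -/

lemma comp_bound {E : Type*} [NormedAddCommGroup E] [NormedSpace ℝ E]
    {F G : E → E} (hF : ContDiff ℝ (⊤ : ℕ∞) F) (hG : ContDiff ℝ (⊤ : ℕ∞) G)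
    (x : E) (k : ℕ) {lam A K : ℝ} (hl : 0 < lam) (hA : 0 ≤ A) (hK : 1 ≤ K)
    (hbF : ∀ j ≤ k, lam ^ j * ‖iteratedFDeriv ℝ (j + 1) F (G x)‖ ≤ A)
    (hbG : ∀ j ≤ k, ‖iteratedFDeriv ℝ (j + 1) G x‖ ≤ K * (lam ^ j)⁻¹) :
    ‖iteratedFDeriv ℝ (k + 1) (F ∘ G) x‖
      ≤ ((k + 1).factorial * A * K ^ (k + 1)) * (lam ^ k)⁻¹ := by
  have htop : ∀ m : ℕ, ((m : ℕ) : WithTop ℕ∞) ≤ ((⊤ : ℕ∞) : WithTop ℕ∞) := fun m => by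
    exact_mod_cast (le_top : (m : ℕ∞) ≤ ⊤)
  have hsub : ∀ (c : E) (H : E → E), ContDiff ℝ (⊤ : ℕ∞) H → ∀ (j : ℕ) (y : E),
      iteratedFDeriv ℝ (j + 1) (fun y => H y - c) y = iteratedFDeriv ℝ (j + 1) H y := by
    intro c H hH j y
    rw [fun_iteratedFDeriv_sub_apply (hH.of_le (htop _)).contDiffAt contDiffAt_const,
      iteratedFDeriv_const_of_ne (by simp)]
    simp
  have hne : lam ≠ 0 := hl.ne'
  set F0 : E → E := fun y => F y - F (G x) with hF0
  have hF0s : ContDiff ℝ (⊤ : ℕ∞) F0 := hF.sub contDiff_const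
  set F1 : E → E := fun y => F0 (lam • y) with hF1
  have hF1s : ContDiff ℝ (⊤ : ℕ∞) F1 := hF0s.comp (contDiff_const_smul lam)
  set F2 : E → E := fun y => lam⁻¹ • F1 y with hF2
  have hF2s : ContDiff ℝ (⊤ : ℕ∞) F2 := hF1s.const_smul lam⁻¹
  set G2 : E → E := fun y => lam⁻¹ • G y with hG2
  have hG2s : ContDiff ℝ (⊤ : ℕ∞) G2 := hG.const_smul lam⁻¹
  have hx : lam • G2 x = G x := by simp [hG2, smul_smul, hne]
  have main := norm_iteratedFDeriv_comp_le (n := k + 1) hF2s hG2s (htop _) x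
    (C := A) (D := K / lam) ?_ ?_
  · have hcomp : F2 ∘ G2 = fun y => lam⁻¹ • ((F ∘ G) y - F (G x)) := by
      funext y
      simp [hF2, hF1, hF0, hG2, smul_smul, hne]
    have hFG : ContDiff ℝ (⊤ : ℕ∞) (F ∘ G) := hF.comp hG
    rw [hcomp, iteratedFDeriv_const_smul_apply'
      ((hFG.sub contDiff_const).of_le (htop _)).contDiffAt, hsub _ _ hFG, norm_smul, norm_inv,
      Real.norm_of_nonneg hl.le] at main
    have h3 := mul_le_mul_of_nonneg_left main hl.le
    rw [← mul_assoc, mul_inv_cancel₀ hne, one_mul] at h3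
    refine h3.trans (le_of_eq ?_)
    rw [div_pow]
    field_simp
    ring
  · intro i hi
    rcases i with _ | j
    · rw [norm_iteratedFDeriv_zero]
      simp only [hF2, hF1, hx, hF0, sub_self, smul_zero, norm_zero]
      exact hA
    · rw [iteratedFDeriv_const_smul_apply' (hF1s.of_le (htop _)).contDiffAt, hF1,
        iteratedFDeriv_comp_const_smul lam (hF0s.of_le (htop _))]
      simp only
      rw [hx, hF0, hsub _ _ hF, norm_smul, norm_smul, norm_inv, norm_pow,
        Real.norm_of_nonneg hl.le]
      refine le_trans (le_of_eq ?_) (hbF j (by omega))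
      field_simp
      ring
  · intro i hi1 hi
    obtain ⟨j, rfl⟩ : ∃ j, i = j + 1 := ⟨i - 1, by omega⟩
    rw [iteratedFDeriv_const_smul_apply' (hG.of_le (htop _)).contDiffAt, norm_smul, norm_inv,
        Real.norm_of_nonneg hl.le]
    have h1 := mul_le_mul_of_nonneg_left (hbG j (by omega)) (inv_nonneg.2 hl.le)
    refine h1.trans ?_
    have h2 : lam⁻¹ * (K * (lam ^ j)⁻¹) = K / lam ^ (j + 1) := by
      field_simp
      ring
    rw [h2, div_pow]
    gcongr
    exact le_self_pow₀ hK (by simp)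

lemma jb_comp_bound {p : ℕ} {σ : ℝ} {G H : (Fin p → ℝ) → (Fin p → ℝ)}
    (hH : GsigmaCl σ H) (hl : Function.LeftInverse H G) :
    ∃ c : ℝ, 1 ≤ c ∧ ∀ x, jb x ≤ c * jb (G x) := by
  rw [GsigmaCl_iff] at hH
  obtain ⟨hs, hb⟩ := hH
  obtain ⟨C, hC, h⟩ := hb 0
  have hL : ∀ y, ‖H y - H 0‖ ≤ C * ‖y - 0‖ := by
    intro y
    refine convex_univ.norm_image_sub_le_of_norm_fderiv_le (𝕜 := ℝ) (f := H) (s := Set.univ)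
      (fun x _ => hs.differentiable (by simp) x) (fun x _ => ?_) (Set.mem_univ 0) (Set.mem_univ y)
    have := h x
    rw [zero_add, norm_iteratedFDeriv_one] at this
    simpa using this
  refine ⟨1 + p * (‖H 0‖ + C), ?_, fun x => ?_⟩
  · have : 0 ≤ (p : ℝ) * (‖H 0‖ + C) := by positivity
    linarith
  · have h1 := hL (G x)
    rw [hl x, sub_zero] at h1
    have h2 : ‖x‖ ≤ ‖H 0‖ + C * ‖G x‖ := by
      have := norm_sub_norm_le x (H 0)
      linarith
    have h3 := norm_le_jb (G x)
    have h4 := one_le_jb (G x)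
    have h5 : ‖x‖ ≤ (‖H 0‖ + C) * jb (G x) := by
      have := norm_nonneg (H 0)
      nlinarith
    calc jb x ≤ 1 + p * ‖x‖ := jb_le x
      _ ≤ jb (G x) + p * ((‖H 0‖ + C) * jb (G x)) := by gcongr
      _ = _ := by ring

lemma GsigmaCl_comp {p : ℕ} {σ : ℝ} (hσ : 0 ≤ σ) {F G H : (Fin p → ℝ) → (Fin p → ℝ)}
    (hF : GsigmaCl σ F) (hG : GsigmaCl σ G) (hH : GsigmaCl σ H)
    (hl : Function.LeftInverse H G) : GsigmaCl σ (F ∘ G) := by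
  obtain ⟨c, hc, hjb⟩ := jb_comp_bound hH hl
  rw [GsigmaCl_iff] at hF hG ⊢
  obtain ⟨hFs, hFb⟩ := hF
  obtain ⟨hGs, hGb⟩ := hG
  refine ⟨hFs.comp hGs, fun k => ?_⟩
  choose CF hCF hFb using hFb
  choose CG hCG hGb using hGb
  have hc0 : 0 ≤ c := zero_le_one.trans hc
  set A : ℝ := 1 + ∑ j ∈ Finset.range (k + 1), (c ^ σ) ^ j * CF j with hA
  set K : ℝ := 1 + ∑ j ∈ Finset.range (k + 1), CG j with hK
  have hA' : ∀ j ≤ k, (c ^ σ) ^ j * CF j ≤ A := by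
    intro j hj
    have := Finset.single_le_sum (f := fun j => (c ^ σ) ^ j * CF j)
      (s := Finset.range (k + 1))
      (fun i _ => mul_nonneg (pow_nonneg (Real.rpow_nonneg hc0 _) _) (hCF i).le)
      (Finset.mem_range.2 (Nat.lt_succ_of_le hj))
    linarith
  have hK' : ∀ j ≤ k, CG j ≤ K := by
    intro j hj
    have := Finset.single_le_sum (f := CG) (s := Finset.range (k + 1))
      (fun i _ => (hCG i).le) (Finset.mem_range.2 (Nat.lt_succ_of_le hj))
    linarith
  have hA1 : 1 ≤ A := by
    have : 0 ≤ ∑ j ∈ Finset.range (k + 1), (c ^ σ) ^ j * CF j :=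
      Finset.sum_nonneg
        (fun i _ => mul_nonneg (pow_nonneg (Real.rpow_nonneg hc0 _) _) (hCF i).le)
    linarith
  have hK1 : 1 ≤ K := by
    have : 0 ≤ ∑ j ∈ Finset.range (k + 1), CG j := Finset.sum_nonneg (fun i _ => (hCG i).le)
    linarith
  refine ⟨(k + 1).factorial * A * K ^ (k + 1), by positivity, fun x => ?_⟩
  have hx1 := one_le_jb x
  have hy1 := one_le_jb (G x)
  have hl0 : 0 < jb x ^ σ := Real.rpow_pos_of_pos (by linarith) _
  have hm0 : 0 < jb (G x) ^ σ := Real.rpow_pos_of_pos (by linarith) _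
  have hlm : jb x ^ σ ≤ c ^ σ * jb (G x) ^ σ := by
    rw [← Real.mul_rpow hc0 (by linarith)]
    exact Real.rpow_le_rpow (by linarith) (hjb x) hσ
  refine comp_bound hFs hGs x k hl0 (by linarith) hK1 (fun j hj => ?_) (fun j hj => ?_)
  · refine le_trans ?_ (hA' j hj)
    calc (jb x ^ σ) ^ j * ‖iteratedFDeriv ℝ (j + 1) F (G x)‖
        ≤ (c ^ σ * jb (G x) ^ σ) ^ j * (CF j * ((jb (G x) ^ σ) ^ j)⁻¹) := by
          gcongr
          exact hFb j (G x)
      _ = (c ^ σ) ^ j * CF j := by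
          rw [mul_pow]
          field_simp
  · refine (hGb j x).trans ?_
    gcongr
    exact hK' j hj

lemma GsigmaCl_linear {p : ℕ} (σ : ℝ) (A : (Fin p → ℝ) →L[ℝ] (Fin p → ℝ)) :
    GsigmaCl σ (fun v => A v) := by
  rw [GsigmaCl_iff]
  refine ⟨A.contDiff, fun k => ⟨‖A‖ + 1, by positivity, fun v => ?_⟩⟩
  have hd : fderiv ℝ (fun v => A v) = fun _ => A := by
    funext x
    exact A.fderiv
  have hj : 0 ≤ jb v := zero_le_one.trans (one_le_jb v)
  rw [← norm_iteratedFDeriv_fderiv, hd]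
  rcases k with _ | k
  · simp
  · rw [iteratedFDeriv_const_of_ne (by simp)]
    simp only [Pi.zero_apply, norm_zero]
    positivity

/-- `G_σ^×(ℝ^p)` is a subgroup of the diffeomorphism group of `ℝ^p`
containing `GL_p(ℝ)`: it is closed under composition and inversion, and contains
every linear automorphism. -/
theorem statement1 {p : ℕ} (σ : ℝ) (hσ : σ ∈ Set.Icc (0 : ℝ) 1)
    (f g : (Fin p → ℝ) → (Fin p → ℝ)) (hf : GsigmaX σ f) (hg : GsigmaX σ g) :
    GsigmaX σ (f ∘ g) ∧
    (∀ h : (Fin p → ℝ) → (Fin p → ℝ),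
      Function.LeftInverse h g → Function.RightInverse h g → GsigmaX σ h) ∧
    (∀ A : (Fin p → ℝ) ≃ₗ[ℝ] (Fin p → ℝ), GsigmaX σ (fun v => A v)) := by
  obtain ⟨f', hf1, hf2, hf3, hf4⟩ := hf
  obtain ⟨g', hg1, hg2, hg3, hg4⟩ := hg
  refine ⟨⟨g' ∘ f', ?_, ?_, ?_, ?_⟩, ?_, ?_⟩
  · exact hf1.comp hg1
  · exact hf2.comp hg2
  · exact GsigmaCl_comp hσ.1 hf3 hg3 hg4 hg1
  · exact GsigmaCl_comp hσ.1 hg4 hf4 hf3 hf2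
  · intro h h1 h2
    have : h = g' := by
      funext y
      rw [← hg1 (h y), h2 y]
    subst this
    exact ⟨g, hg2, hg1, hg4, hg3⟩
  · intro A
    refine ⟨fun v => A.symm v, A.symm_apply_apply, A.apply_symm_apply, ?_, ?_⟩
    · exact GsigmaCl_linear σ (LinearMap.toContinuousLinearMap A.toLinearMap)
    · exact GsigmaCl_linear σ (LinearMap.toContinuousLinearMap A.symm.toLinearMap)
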